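/- arXiv:1504.06240 — 2 statements merged into one kernel-verified Lean document; each statement's English description precedes it below -/
import Mathlib

section
/- Runtime bound: let s be a nonempty binary string and τ a Turing machine in (k,2). If the run τ(i) halts with output s, then it halts within at most 2^(|s|) · |s| · k computation steps; equivalently, any machine in (k,2) that runs for more than 2^(|s|) · |s| · k steps either never halts or does not produce s. -/
/-- An instruction of a Busy Beaver machine: `Sum.inl b` means "write `b` and move to the
halting state (no head movement)"; `Sum.inr (q, b, d)` means "write `b`, move the head in
direction `d` (`true` = right, `false` = left) and change to state `q`".  For the class
`(n,2)` there are `4 * n + 2` instructions. -/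
abbrev Instr (n : ℕ) := Bool ⊕ (Fin n × Bool × Bool)

/-- A Turing machine in the class `(n,2)`: a transition table assigning an instruction to
every pair (current state, read symbol). -/
abbrev Machine (n : ℕ) := (Fin n × Bool) → Instr n

/-- A configuration: current state (`none` = halted), tape contents, head position, and the
interval `[lo, hi]` of cells visited so far by the head. -/
structure Config (n : ℕ) where
  state : Option (Fin n)
  tape : ℤ → Bool
  pos : ℤ
  lo : ℤ
  hi : ℤ

/-- One computation step. -/
def step {n : ℕ} (M : Machine n) (c : Config n) : Config n :=
  match c.state with
  | none => c
  | some q =>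
    match M (q, c.tape c.pos) with
    | Sum.inl b => { c with state := none, tape := Function.update c.tape c.pos b }
    | Sum.inr (q', b, d) =>
      let p := c.pos + (if d then 1 else -1)
      { state := some q', tape := Function.update c.tape c.pos b,
        pos := p, lo := min c.lo p, hi := max c.hi p }

/-- The initial configuration on a tape uniformly filled with the blank symbol `i`,
started in the initial state (state `⟨0, _⟩`, i.e. state "1" of `{1,…,n}`). -/
def initConfig (n : ℕ) (i : Bool) : Config n :=
  { state := if h : 0 < n then some ⟨0, h⟩ else none,
    tape := fun _ => i, pos := 0, lo := 0, hi := 0 }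

/-- The configuration after `t` steps of the run `τ(i)`. -/
def cfgAt {n : ℕ} (M : Machine n) (i : Bool) (t : ℕ) : Config n :=
  (step M)^[t] (initConfig n i)

/-- A configuration is halted when the machine has entered the halting state. -/
def Halted {n : ℕ} (c : Config n) : Prop := c.state = none

/-- The output read off a configuration: the symbols in the cells visited by the head. -/
def outputOf {n : ℕ} (c : Config n) : List Bool :=
  (List.range (c.hi - c.lo + 1).toNat).map fun j => c.tape (c.lo + j)

/-- `Outputs M i s` : the run `τ(i)` of `M` on blank symbol `i` halts with output `s`. -/
def Outputs {n : ℕ} (M : Machine n) (i : Bool) (s : List Bool) : Prop :=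
  ∃ t, Halted (cfgAt M i t) ∧ outputOf (cfgAt M i t) = s

/-- `|{τ ∈ (n,2) : τ(i) = s}|`. -/
noncomputable def numOutput (n : ℕ) (i : Bool) (s : List Bool) : ℕ :=
  Nat.card {τ : Machine n // Outputs τ i s}

/-- The exponent `n + 1 + ⌈log₂((4n+2)^(2n))⌉` (the length of the program encodings
with `n` states). -/
def expo (n : ℕ) : ℕ := n + 1 + Nat.clog 2 ((4 * n + 2) ^ (2 * n))

/-- The `n`-th term of the series defining `m(s)`. -/
noncomputable def mTerm (n : ℕ) (s : List Bool) : ℝ :=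
  ((numOutput n false s + numOutput n true s : ℕ) : ℝ) / 2 ^ expo n

/-- The measure `m(s) = Σ_{n=1}^∞ (|{τ ∈ (n,2) : τ(0)=s}| + |{τ ∈ (n,2) : τ(1)=s}|) /
2^(n+1+⌈log₂((4n+2)^(2n))⌉)`. -/
noncomputable def mDist (s : List Bool) : ℝ := ∑' j : ℕ, mTerm (j + 1) s

/-- The finite approximation `m_k(s)`: the same sum truncated to `1 ≤ n ≤ k`. -/
noncomputable def mApprox (k : ℕ) (s : List Bool) : ℝ :=
  ∑ n ∈ Finset.Icc 1 k, mTerm n s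

/-- The finite approximation `m_k(s)` as a rational number. -/
noncomputable def mApproxQ (k : ℕ) (s : List Bool) : ℚ :=
  ∑ n ∈ Finset.Icc 1 k,
    ((numOutput n false s + numOutput n true s : ℕ) : ℚ) / 2 ^ expo n

/-- Two configurations agree up to the record of visited cells. -/
def Config.Agree {n : ℕ} (c c' : Config n) : Prop :=
  c.state = c'.state ∧ c.tape = c'.tape ∧ c.pos = c'.pos

theorem Config.Agree.step {n : ℕ} (M : Machine n) {c c' : Config n} (h : c.Agree c') :
    (step M c).Agree (step M c') := by
  obtain ⟨q, T, p, l, u⟩ := c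
  obtain ⟨q', T', p', l', u'⟩ := c'
  obtain ⟨h₁, h₂, h₃⟩ := h
  dsimp only at h₁ h₂ h₃
  subst h₁ h₂ h₃
  rcases q with _ | q
  · exact ⟨rfl, rfl, rfl⟩
  · rcases hM : M (q, T p) with b | ⟨r, b, d⟩ <;> simp [Config.Agree, _root_.step, hM]

theorem cfgAt_succ {n : ℕ} (M : Machine n) (i : Bool) (t : ℕ) :
    cfgAt M i (t + 1) = step M (cfgAt M i t) :=
  Function.iterate_succ_apply' _ _ _

theorem Config.Agree.cfgAt_add {n : ℕ} {M : Machine n} {i : Bool} {a b : ℕ}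
    (h : (cfgAt M i a).Agree (cfgAt M i b)) (m : ℕ) :
    (cfgAt M i (a + m)).Agree (cfgAt M i (b + m)) := by
  induction m with
  | zero => exact h
  | succ m ih =>
    rw [← add_assoc, ← add_assoc, cfgAt_succ, cfgAt_succ]
    exact ih.step M

theorem step_of_halted {n : ℕ} (M : Machine n) {c : Config n} (h : Halted c) :
    step M c = c := by
  obtain ⟨q, T, p, l, u⟩ := c
  obtain rfl : q = none := h
  rfl

theorem cfgAt_eq_of_halted {n : ℕ} {M : Machine n} {i : Bool} {a b : ℕ}
    (h : Halted (cfgAt M i a)) (hab : a ≤ b) : cfgAt M i b = cfgAt M i a := by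
  induction b, hab using Nat.le_induction with
  | base => rfl
  | succ b _ ih => rw [cfgAt_succ, ih, step_of_halted M h]

/-- The head lies in the visited interval, and all cells outside it carry the blank symbol. -/
def Config.Confined {n : ℕ} (i : Bool) (c : Config n) : Prop :=
  c.lo ≤ c.pos ∧ c.pos ≤ c.hi ∧ ∀ x, x < c.lo ∨ c.hi < x → c.tape x = i

theorem Config.Confined.step {n : ℕ} (M : Machine n) {i : Bool} {c : Config n}
    (h : c.Confined i) : (step M c).Confined i := by
  obtain ⟨q, T, p, l, u⟩ := c
  obtain ⟨h₁, h₂, h₃⟩ := h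
  dsimp only at h₁ h₂ h₃
  rcases q with _ | q
  · exact ⟨h₁, h₂, h₃⟩
  · rcases hM : M (q, T p) with b | ⟨r, b, d⟩
    · simp only [Config.Confined, _root_.step, hM]
      refine ⟨h₁, h₂, fun x hx => ?_⟩
      rw [Function.update_of_ne (by lia), h₃ x hx]
    · simp only [Config.Confined, _root_.step, hM]
      refine ⟨min_le_right _ _, le_max_right _ _, fun x hx => ?_⟩
      rw [Function.update_of_ne (by lia), h₃ x (by lia)]

theorem cfgAt_confined {n : ℕ} (M : Machine n) (i : Bool) (t : ℕ) :
    (cfgAt M i t).Confined i := by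
  induction t with
  | zero => exact ⟨le_rfl, le_rfl, fun _ _ => rfl⟩
  | succ t ih => rw [cfgAt_succ]; exact ih.step M

theorem lo_step_le {n : ℕ} (M : Machine n) (c : Config n) : (step M c).lo ≤ c.lo := by
  unfold step
  split
  · rfl
  · split
    · rfl
    · exact min_le_left _ _

theorem le_hi_step {n : ℕ} (M : Machine n) (c : Config n) : c.hi ≤ (step M c).hi := by
  unfold step
  split
  · rfl
  · split
    · rfl
    · exact le_max_left _ _

theorem antitone_lo_cfgAt {n : ℕ} (M : Machine n) (i : Bool) :
    Antitone fun t => (cfgAt M i t).lo :=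
  antitone_nat_of_succ_le fun t => by
    rw [cfgAt_succ]
    exact lo_step_le M _

theorem monotone_hi_cfgAt {n : ℕ} (M : Machine n) (i : Bool) :
    Monotone fun t => (cfgAt M i t).hi :=
  monotone_nat_of_le_succ fun t => by
    rw [cfgAt_succ]
    exact le_hi_step M _

/-- The first halting time is bounded by the number of configurations confined to the cells
visited up to that time. -/
theorem halting_time_le {k : ℕ} (M : Machine k) (i : Bool) {T : ℕ}
    (hT : Halted (cfgAt M i T)) (hmin : ∀ t < T, ¬ Halted (cfgAt M i t)) :
    T ≤ 2 ^ (outputOf (cfgAt M i T)).length * (outputOf (cfgAt M i T)).length * k := by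
  set C := Finset.Icc (cfgAt M i T).lo (cfgAt M i T).hi
  have hcard : Fintype.card C = (outputOf (cfgAt M i T)).length := by
    simp [C, outputOf]
    lia
  have hlo (t : Fin T) : (cfgAt M i T).lo ≤ (cfgAt M i t).lo :=
    antitone_lo_cfgAt M i t.2.le
  have hhi (t : Fin T) : (cfgAt M i t).hi ≤ (cfgAt M i T).hi :=
    monotone_hi_cfgAt M i t.2.le
  have hstate (t : Fin T) : ∃ q, (cfgAt M i t).state = some q :=
    Option.ne_none_iff_exists'.mp (hmin t t.2)
  choose q hq using hstate
  have hpos (t : Fin T) : (cfgAt M i t).pos ∈ C := by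
    obtain ⟨h₁, h₂, -⟩ := cfgAt_confined M i t
    exact Finset.mem_Icc.mpr ⟨(hlo t).trans h₁, h₂.trans (hhi t)⟩
  let f : Fin T → (C → Bool) × C × Fin k := fun t =>
    (fun x => (cfgAt M i t).tape x, ⟨(cfgAt M i t).pos, hpos t⟩, q t)
  have hagree {a b : Fin T} (hab : f a = f b) : (cfgAt M i a).Agree (cfgAt M i b) := by
    simp only [f, Prod.mk.injEq, Subtype.mk.injEq] at hab
    obtain ⟨htape, hp, hs⟩ := hab
    refine ⟨by rw [hq, hq, hs], funext fun x => ?_, hp⟩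
    by_cases hx : x ∈ C
    · exact congrFun htape ⟨x, hx⟩
    · simp only [C, Finset.mem_Icc] at hx
      have := hlo a
      have := hhi a
      have := hlo b
      have := hhi b
      rw [(cfgAt_confined M i a).2.2 x (by lia), (cfgAt_confined M i b).2.2 x (by lia)]
  have hnlt {a b : Fin T} (hab : f a = f b) : ¬ a < b := fun hlt => by
    have h := ((hagree hab).cfgAt_add (T - b)).1
    have hb : (b : ℕ) + (T - b) = T := by lia
    rw [hb] at h
    exact hmin (a + (T - b)) (by lia) (h.trans hT)
  have hinj : Function.Injective f := fun a b hab =>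
    le_antisymm (not_lt.mp (hnlt hab.symm)) (not_lt.mp (hnlt hab))
  have := Fintype.card_le_of_injective f hinj
  simpa only [Fintype.card_prod, Fintype.card_fun, Fintype.card_fin, Fintype.card_bool, hcard,
    mul_assoc] using this

/-- Runtime bound: a machine with `k` states producing the nonempty string `s` halts within
`2^|s| · |s| · k` steps. -/
theorem runtime_bound (k : ℕ) (hk : 1 ≤ k) (s : List Bool) (hs : s ≠ [])
    (τ : Machine k) (i : Bool) (h : Outputs τ i s) :
    ∃ t ≤ 2 ^ s.length * s.length * k,
      Halted (cfgAt τ i t) ∧ outputOf (cfgAt τ i t) = s := by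
  classical
  have hex : ∃ t, Halted (cfgAt τ i t) := h.imp fun _ ht => ht.1
  obtain ⟨t, ht, rfl⟩ := h
  rw [cfgAt_eq_of_halted (Nat.find_spec hex) (Nat.find_min' hex ht)]
  exact ⟨Nat.find hex, halting_time_le τ i (Nat.find_spec hex) fun _ => Nat.find_min hex,
    Nat.find_spec hex, rfl⟩
end

section
/- The function that takes a nonempty binary string s to the least k ≥ 1 such that m_k(s) > 0 is well defined (such a k exists and is at most |s|) and computable. -/
/-- The least `k ≥ 1` with `m_k(s) > 0`. -/
noncomputable def leastK (s : List Bool) : ℕ := sInf {k | 1 ≤ k ∧ 0 < mApprox k s}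

/-- A configuration in zipper form: the state (`0` = halted, `q + 1` = active state `q`), the
visited cells left of the head (nearest first), the scanned symbol, and the visited cells right
of the head (nearest first). -/
abbrev Zipper := ℕ × List Bool × Bool × List Bool

/-- One step on zippers, for the blank symbol `i` and the transition table `f`, whose entries
are instruction codes in the sense of `instrCode`. -/
def zipStep (f : ℕ → Bool → ℕ) (i : Bool) (z : Zipper) : Zipper :=
  if z.1 = 0 then z
  else if f (z.1 - 1) z.2.2.1 / 4 = 0 then
    (0, z.2.1, decide (f (z.1 - 1) z.2.2.1 % 2 = 1), z.2.2.2)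
  else if f (z.1 - 1) z.2.2.1 / 2 % 2 = 1 then
    (f (z.1 - 1) z.2.2.1 / 4, decide (f (z.1 - 1) z.2.2.1 % 2 = 1) :: z.2.1,
      z.2.2.2.head?.getD i, z.2.2.2.tail)
  else
    (f (z.1 - 1) z.2.2.1 / 4, z.2.1.tail, z.2.1.head?.getD i,
      decide (f (z.1 - 1) z.2.2.1 % 2 = 1) :: z.2.2.2)

/-- The zipper after `t` steps of the run on blank symbol `i`. -/
def zipRun (f : ℕ → Bool → ℕ) (i : Bool) (t : ℕ) : Zipper :=
  (zipStep f i)^[t] (1, [], i, [])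

/-- The visited part of the tape. -/
def zipOutput (z : Zipper) : List Bool := z.2.1.reverse ++ z.2.2.1 :: z.2.2.2

/-- The code of an instruction; the codes for `n` states are the numbers in `[2, 4 * n + 4)`. -/
def instrCode {n : ℕ} : Instr n → ℕ
  | Sum.inl b => 2 + b.toNat
  | Sum.inr (q, b, d) => 4 * (q + 1) + 2 * d.toNat + b.toNat

/-- The transition table `f` codes the machine `M`. -/
def Codes {n : ℕ} (f : ℕ → Bool → ℕ) (M : Machine n) : Prop :=
  ∀ (q : Fin n) (h : Bool), f q h = instrCode (M (q, h))

/-- The zipper `z` represents the configuration `c` on a tape with blank symbol `i`. -/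
structure Represents {n : ℕ} (i : Bool) (c : Config n) (z : Zipper) : Prop where
  state : z.1 = c.state.elim 0 fun q => (q : ℕ) + 1
  lo : c.lo = c.pos - z.2.1.length
  hi : c.hi = c.pos + z.2.2.2.length
  head : c.tape c.pos = z.2.2.1
  left : ∀ j : ℕ, c.tape (c.pos - 1 - j) = z.2.1[j]?.getD i
  right : ∀ j : ℕ, c.tape (c.pos + 1 + j) = z.2.2.2[j]?.getD i

theorem represents_initConfig {n : ℕ} (hn : 0 < n) (i : Bool) :
    Represents i (initConfig n i) (1, [], i, []) := by
  constructor <;> simp [initConfig, hn]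

theorem Represents.step {n : ℕ} {i : Bool} {c : Config n} {z : Zipper} {f : ℕ → Bool → ℕ}
    {M : Machine n} (hf : Codes f M) (hc : Represents i c z) :
    Represents i (step M c) (zipStep f i z) := by
  obtain ⟨st, tape, pos, lo, hi⟩ := c
  obtain ⟨q, l, h, r⟩ := z
  obtain ⟨h1, h2, h3, h4, h5, h6⟩ := hc
  simp only at h1 h2 h3 h4 h5 h6
  subst h2 h3 h4
  cases st with
  | none =>
    obtain rfl : q = 0 := by simpa using h1
    simp only [_root_.step, zipStep, if_true]
    exact ⟨rfl, rfl, rfl, rfl, h5, h6⟩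
  | some p =>
    obtain rfl : q = p + 1 := by simpa using h1
    have hfp := hf p (tape pos)
    rcases hM : M (p, tape pos) with b | ⟨p', b, d⟩
    · have e0 : (2 + b.toNat) / 4 = 0 := by cases b <;> rfl
      have e1 : decide ((2 + b.toNat) % 2 = 1) = b := by cases b <;> rfl
      simp only [_root_.step, zipStep, hM, hfp, instrCode, Nat.add_sub_cancel, e0, e1,
        Nat.add_one_ne_zero, if_false, if_true]
      refine ⟨rfl, rfl, rfl, by simp, fun j => ?_, fun j => ?_⟩
      · rw [← h5 j]
        exact Function.update_of_ne (by lia) _ _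
      · rw [← h6 j]
        exact Function.update_of_ne (by lia) _ _
    · have hb : b.toNat ≤ 1 := Bool.toNat_le b
      have e0 : (4 * ((p' : ℕ) + 1) + 2 * d.toNat + b.toNat) / 4 = p' + 1 := by
        cases d <;> simp <;> omega
      have e1 : decide ((4 * ((p' : ℕ) + 1) + 2 * d.toNat + b.toNat) % 2 = 1) = b := by
        cases b <;> simp <;> omega
      have e2 : ((4 * ((p' : ℕ) + 1) + 2 * d.toNat + b.toNat) / 2 % 2 = 1) ↔ d = true := by
        cases d <;> simp <;> omega
      simp only [_root_.step, zipStep, hM, hfp, instrCode, Nat.add_sub_cancel, e0, e1, e2,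
        Nat.add_one_ne_zero, if_false]
      cases d
      · refine ⟨rfl, ?_, ?_, ?_, fun j => ?_, fun j => ?_⟩
        · cases l <;> simp; lia
        · cases l <;> simp <;> lia
        · have := h5 0
          simp only [if_neg, Bool.false_eq_true, not_false_eq_true]
          rw [Function.update_of_ne (by lia)]
          rw [List.head?_eq_getElem?, ← this]
          congr 1
          simp; lia
        · simp only [if_neg, Bool.false_eq_true, not_false_eq_true]
          rw [Function.update_of_ne (by lia), List.getElem?_tail, ← h5 (j + 1)]
          congr 1
          push_cast
          lia
        · simp only [if_neg, Bool.false_eq_true, not_false_eq_true]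
          cases j with
          | zero => simp
          | succ j =>
            rw [Function.update_of_ne (by lia), List.getElem?_cons_succ, ← h6 j]
            congr 1
            push_cast
            lia
      · refine ⟨rfl, ?_, ?_, ?_, fun j => ?_, fun j => ?_⟩
        · cases r <;> simp <;> lia
        · cases r <;> simp; lia
        · have := h6 0
          simp only [if_true]
          rw [Function.update_of_ne (by lia)]
          rw [List.head?_eq_getElem?, ← this]
          congr 1
          simp
        · simp only [if_true]
          cases j with
          | zero => simp
          | succ j =>
            rw [Function.update_of_ne (by lia), List.getElem?_cons_succ, ← h5 j]
            congr 1
            push_cast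
            lia
        · simp only [if_true]
          rw [Function.update_of_ne (by lia), List.getElem?_tail, ← h6 (j + 1)]
          congr 1
          push_cast
          lia

theorem represents_zipRun {n : ℕ} (hn : 0 < n) (i : Bool) {f : ℕ → Bool → ℕ}
    {M : Machine n} (hf : Codes f M) (t : ℕ) :
    Represents i (cfgAt M i t) (zipRun f i t) := by
  induction t with
  | zero => exact represents_initConfig hn i
  | succ t ih =>
    simp only [cfgAt, zipRun, Function.iterate_succ_apply']
    exact ih.step hf

theorem Represents.halted_iff {n : ℕ} {i : Bool} {c : Config n} {z : Zipper}
    (hc : Represents i c z) : Halted c ↔ z.1 = 0 := by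
  rw [hc.state, Halted]
  cases c.state <;> simp

theorem outputOf_eq_map {n : ℕ} (c : Config n) :
    outputOf c = (List.range (c.hi - c.lo + 1).toNat).map fun j : ℕ => c.tape (c.lo + j) := by
  simp [outputOf, List.map_eq_flatMap, List.flatMap_assoc]

theorem Represents.outputOf_eq {n : ℕ} {i : Bool} {c : Config n} {z : Zipper}
    (hc : Represents i c z) : outputOf c = zipOutput z := by
  have hlen : (c.hi - c.lo + 1).toNat = z.2.1.length + (z.2.2.2.length + 1) := by
    rw [hc.hi, hc.lo]
    lia
  apply List.ext_getElem
  · simp [outputOf_eq_map, zipOutput, hlen]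
  · intro j h1 h2
    simp only [outputOf_eq_map, zipOutput, List.getElem_map, List.getElem_range, hc.lo]
    simp only [zipOutput, List.length_append, List.length_reverse, List.length_cons] at h2
    rcases lt_trichotomy j z.2.1.length with h | h | h
    · rw [List.getElem_append_left (by simpa using h), List.getElem_reverse]
      have := hc.left (z.2.1.length - 1 - j)
      rw [List.getElem?_eq_getElem (by lia), Option.getD_some] at this
      rw [← this]
      congr 1
      lia
    · subst h
      rw [List.getElem_append_right (by simp)]
      simp [hc.head]
    · rw [List.getElem_append_right (by simpa using h.le)]
      have := hc.right (j - z.2.1.length - 1)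
      rw [List.getElem?_eq_getElem (by lia), Option.getD_some] at this
      obtain ⟨k, rfl⟩ : ∃ k, j = z.2.1.length + 1 + k := ⟨j - z.2.1.length - 1, by lia⟩
      have e : z.2.1.length + 1 + k - z.2.1.reverse.length = k + 1 := by simp; lia
      simp only [e, List.getElem_cons_succ]
      simp only [show z.2.1.length + 1 + k - z.2.1.length - 1 = k by lia] at this
      rw [← this]
      congr 1
      push_cast
      lia

/-- The run described by the table `f` on blank symbol `i` halts with output `s`. -/
def ZipOutputs (f : ℕ → Bool → ℕ) (i : Bool) (s : List Bool) : Prop :=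
  ∃ t, (zipRun f i t).1 = 0 ∧ zipOutput (zipRun f i t) = s

theorem outputs_iff_zipOutputs {n : ℕ} (hn : 0 < n) (i : Bool) {f : ℕ → Bool → ℕ}
    {M : Machine n} (hf : Codes f M) (s : List Bool) :
    Outputs M i s ↔ ZipOutputs f i s :=
  exists_congr fun t => by
    have h := represents_zipRun hn i hf t
    rw [h.halted_iff, h.outputOf_eq]

/-! ### A machine with `|s|` states that outputs `s` -/

theorem exists_outputs {s : List Bool} (hs : s ≠ []) :
    ∃ M : Machine s.length, Outputs M false s := by
  have hpos : 0 < s.length := List.length_pos_iff.2 hs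
  let M : Machine s.length := fun x =>
    if h : (x.1 : ℕ) + 1 < s.length then Sum.inr (⟨x.1 + 1, h⟩, s[x.1], true)
    else Sum.inl s[x.1]
  let f : ℕ → Bool → ℕ := fun q h => if hq : q < s.length then instrCode (M (⟨q, hq⟩, h)) else 0
  have hf : Codes f M := fun q h => by simp [f]
  have hrun : ∀ t < s.length, zipRun f false t = (t + 1, (s.take t).reverse, false, []) := by
    intro t
    induction t with
    | zero => intro _; rfl
    | succ t ih =>
      intro ht
      have hfv : f t false = 4 * (t + 1 + 1) + 2 + s[t].toNat := by
        simp [f, M, instrCode, ht, show t < s.length by lia]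
      have hb : s[t].toNat ≤ 1 := Bool.toNat_le _
      rw [zipRun, Function.iterate_succ_apply', ← zipRun, ih (by lia), zipStep]
      simp only [Nat.add_sub_cancel, hfv]
      rw [if_neg (by lia), if_neg (by lia), if_pos (by lia)]
      rw [show (4 * (t + 1 + 1) + 2 + s[t].toNat) / 4 = t + 1 + 1 by lia,
        show decide ((4 * (t + 1 + 1) + 2 + s[t].toNat) % 2 = 1) = s[t] by
          cases s[t] <;> simp <;> omega]
      rw [List.take_succ_eq_append_getElem (by lia), List.reverse_append]
      rfl
  refine ⟨M, (outputs_iff_zipOutputs hpos false hf s).2 ⟨s.length, ?_⟩⟩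
  obtain ⟨L, hL⟩ : ∃ L, s.length = L + 1 := ⟨s.length - 1, by lia⟩
  have hfv : f L false = 2 + s[L].toNat := by
    simp [f, M, instrCode, hL]
  have hb : s[L].toNat ≤ 1 := Bool.toNat_le _
  rw [hL, zipRun, Function.iterate_succ_apply', ← zipRun, hrun L (by lia), zipStep]
  simp only [Nat.add_sub_cancel, hfv]
  rw [if_neg (by lia), if_pos (by lia),
    show decide ((2 + s[L].toNat) % 2 = 1) = s[L] by cases s[L] <;> simp]
  refine ⟨rfl, ?_⟩
  simp only [zipOutput, List.reverse_reverse]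
  rw [← List.take_succ_eq_append_getElem (by lia), List.take_of_length_le (by lia)]

/-! ### Coding transition tables by numbers -/

/-- The transition table coded by the base-`(4 * n + 2)` digits of `m`. -/
def zipTable (n m q : ℕ) (h : Bool) : ℕ :=
  m / (4 * n + 2) ^ (2 * q + h.toNat) % (4 * n + 2) + 2

theorem zipTable_div_four_le (n m q : ℕ) (h : Bool) : zipTable n m q h / 4 ≤ n := by
  have : m / (4 * n + 2) ^ (2 * q + h.toNat) % (4 * n + 2) < 4 * n + 2 :=
    Nat.mod_lt _ (by lia)
  rw [zipTable]
  lia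

theorem two_le_instrCode {n : ℕ} (x : Instr n) : 2 ≤ instrCode x := by
  rcases x with b | ⟨q, b, d⟩ <;> simp only [instrCode] <;> lia

theorem instrCode_lt {n : ℕ} (hn : 0 < n) (x : Instr n) : instrCode x < 4 * n + 4 := by
  rcases x with b | ⟨q, b, d⟩
  · have := Bool.toNat_le b
    simp only [instrCode]
    lia
  · have := Bool.toNat_le b
    have := Bool.toNat_le d
    simp only [instrCode]
    lia

theorem exists_instrCode_eq {n e : ℕ} (h1 : 2 ≤ e) (h2 : e < 4 * n + 4) :
    ∃ x : Instr n, instrCode x = e := by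
  have toNat (k : ℕ) : (decide (k % 2 = 1)).toNat = k % 2 := by
    rcases Nat.mod_two_eq_zero_or_one k with h | h <;> simp [h]
  by_cases h : e < 4
  · refine ⟨Sum.inl (decide (e % 2 = 1)), ?_⟩
    simp only [instrCode, toNat]
    lia
  · refine ⟨Sum.inr (⟨e / 4 - 1, by lia⟩, decide (e % 2 = 1), decide (e / 2 % 2 = 1)), ?_⟩
    simp only [instrCode, toNat]
    lia

theorem exists_codes_zipTable (n m : ℕ) : ∃ M : Machine n, Codes (zipTable n m) M := by
  have (x : Fin n × Bool) : ∃ y : Instr n, instrCode y = zipTable n m x.1 x.2 := by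
    refine exists_instrCode_eq (by simp [zipTable]) ?_
    have := zipTable_div_four_le n m x.1 x.2
    lia
  choose M hM using this
  exact ⟨M, fun q h => (hM (q, h)).symm⟩

theorem exists_zipTable_codes {n : ℕ} (hn : 0 < n) (M : Machine n) :
    ∃ m < (4 * n + 2) ^ (2 * n), Codes (zipTable n m) M := by
  let g : Fin (2 * n) → Fin (4 * n + 2) := fun j =>
    ⟨instrCode (M (⟨j / 2, by lia⟩, decide ((j : ℕ) % 2 = 1))) - 2, by
      have := instrCode_lt hn (M (⟨j / 2, by lia⟩, decide ((j : ℕ) % 2 = 1)))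
      lia⟩
  refine ⟨finFunctionFinEquiv g, Fin.is_lt _, fun q h => ?_⟩
  have hj : 2 * (q : ℕ) + h.toNat < 2 * n := by
    have := Bool.toNat_le h
    lia
  have key := congrArg Fin.val
    (congrFun (finFunctionFinEquiv.symm_apply_apply g) ⟨2 * (q : ℕ) + h.toNat, hj⟩)
  rw [finFunctionFinEquiv_symm_apply_val] at key
  have hx : (⟨(2 * (q : ℕ) + h.toNat) / 2, by lia⟩,
      decide ((2 * (q : ℕ) + h.toNat) % 2 = 1)) = ((q, h) : Fin n × Bool) := by
    cases h <;> simp [Fin.ext_iff]; lia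
  have := two_le_instrCode (M (q, h))
  simp only [zipTable, key, g, hx]
  lia

/-! ### A bound on the running time -/

/-- Bijective base-two numeration. -/
def binCode : List Bool → ℕ
  | [] => 0
  | b :: l => 2 * binCode l + b.toNat + 1

theorem binCode_injective : Function.Injective binCode := by
  intro l₁
  induction l₁ with
  | nil =>
    intro l₂ h
    cases l₂ with
    | nil => rfl
    | cons b l => simp [binCode] at h
  | cons b l ih =>
    intro l₂ h
    cases l₂ with
    | nil => simp [binCode] at h
    | cons b' l' =>
      simp only [binCode] at h
      have h1 := Bool.toNat_le b
      have h2 := Bool.toNat_le b'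
      rw [ih (show binCode l = binCode l' by lia)]
      congr 1
      cases b <;> cases b' <;> simp at h ⊢ <;> lia

theorem binCode_lt (l : List Bool) : binCode l + 1 < 2 ^ (l.length + 1) := by
  induction l with
  | nil => simp [binCode]
  | cons b l ih =>
    have := Bool.toNat_le b
    rw [binCode, List.length_cons, pow_succ]
    lia

/-- A bound on the halting time of a machine with `n` states whose output has length `L`. -/
def timeBound (n L : ℕ) : ℕ := (n + 1) * (2 ^ L * (2 * 2 ^ L))

theorem length_zipOutput_le_zipStep (f : ℕ → Bool → ℕ) (i : Bool) (z : Zipper) :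
    (zipOutput z).length ≤ (zipOutput (zipStep f i z)).length := by
  unfold zipStep
  split_ifs <;> simp [zipOutput] <;> lia

theorem length_zipOutput_zipRun_mono (f : ℕ → Bool → ℕ) (i : Bool) :
    Monotone fun t => (zipOutput (zipRun f i t)).length :=
  monotone_nat_of_le_succ fun t => by
    simp only [zipRun, Function.iterate_succ_apply']
    exact length_zipOutput_le_zipStep f i _

theorem zipRun_state_le {n : ℕ} (hn : 0 < n) {f : ℕ → Bool → ℕ} (hf : ∀ q h, f q h / 4 ≤ n)
    (i : Bool) (t : ℕ) : (zipRun f i t).1 ≤ n := by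
  induction t with
  | zero => exact hn
  | succ t ih =>
    rw [zipRun, Function.iterate_succ_apply', ← zipRun, zipStep]
    split_ifs
    exacts [ih, n.zero_le, hf _ _, hf _ _]

theorem zipRun_eq_of_halted {f : ℕ → Bool → ℕ} {i : Bool} {t u : ℕ}
    (h : (zipRun f i t).1 = 0) (htu : t ≤ u) : zipRun f i u = zipRun f i t := by
  obtain ⟨v, rfl⟩ := Nat.exists_eq_add_of_le' htu
  rw [zipRun, Function.iterate_add_apply]
  exact Function.iterate_fixed (by rw [← zipRun, zipStep, if_pos h]) v

theorem zipRun_add_congr {f : ℕ → Bool → ℕ} {i : Bool} {t u : ℕ}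
    (h : zipRun f i t = zipRun f i u) (v : ℕ) : zipRun f i (v + t) = zipRun f i (v + u) := by
  simp only [zipRun, Function.iterate_add_apply] at h ⊢
  rw [h]

theorem zipOutputs_iff_timeBound {n : ℕ} (hn : 0 < n) {f : ℕ → Bool → ℕ}
    (hf : ∀ q h, f q h / 4 ≤ n) (i : Bool) (s : List Bool) :
    ZipOutputs f i s ↔ (zipRun f i (timeBound n s.length)).1 = 0 ∧
      zipOutput (zipRun f i (timeBound n s.length)) = s := by
  refine ⟨fun ⟨t, ht, hs⟩ => ?_, fun h => ⟨_, h⟩⟩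
  have hex : ∃ t, (zipRun f i t).1 = 0 := ⟨t, ht⟩
  classical
  let t₀ := Nat.find hex
  have h₀ : (zipRun f i t₀).1 = 0 := Nat.find_spec hex
  have hrun : zipRun f i t = zipRun f i t₀ := zipRun_eq_of_halted h₀ (Nat.find_min' hex ht)
  have hinj : ∀ u v, u < v → v ≤ t₀ → zipRun f i u ≠ zipRun f i v := by
    intro u v huv hv h
    have h' := zipRun_add_congr h (t₀ - v)
    rw [Nat.sub_add_cancel hv] at h'
    exact Nat.find_min hex (show t₀ - v + u < t₀ by lia) (by rw [h', h₀])
  let code : ℕ → ℕ × ℕ × Bool × ℕ := fun u =>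
    ((zipRun f i u).1, binCode (zipRun f i u).2.1, (zipRun f i u).2.2.1,
      binCode (zipRun f i u).2.2.2)
  have hcard : (Finset.range (t₀ + 1)).card ≤ (Finset.range (n + 1) ×ˢ
      Finset.range (2 ^ s.length) ×ˢ (Finset.univ : Finset Bool) ×ˢ
      Finset.range (2 ^ s.length)).card := by
    refine Finset.card_le_card_of_injOn code (fun u hu => ?_) (fun u hu v hv h => ?_)
    · have hu' : u ≤ t₀ := by simpa [Nat.lt_succ_iff] using hu
      have hlen : (zipOutput (zipRun f i u)).length ≤ s.length := by
        rw [← hs, hrun]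
        exact length_zipOutput_zipRun_mono f i hu'
      simp only [zipOutput, List.length_append, List.length_reverse, List.length_cons] at hlen
      have hpow (l : List Bool) (hl : l.length + 1 ≤ s.length) : binCode l < 2 ^ s.length :=
        (Nat.lt_of_succ_lt (binCode_lt l)).trans_le (Nat.pow_le_pow_right two_pos hl)
      simp only [code, Finset.coe_product, Set.mem_prod, Finset.mem_coe, Finset.mem_range,
        Finset.mem_univ, true_and]
      exact ⟨Nat.lt_succ_of_le (zipRun_state_le hn hf i u), hpow _ (by lia), hpow _ (by lia)⟩
    · have hu' : u ≤ t₀ := by simpa [Nat.lt_succ_iff] using hu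
      have hv' : v ≤ t₀ := by simpa [Nat.lt_succ_iff] using hv
      have heq : zipRun f i u = zipRun f i v := by
        simp only [code, Prod.mk.injEq] at h
        exact Prod.ext h.1 (Prod.ext (binCode_injective h.2.1)
          (Prod.ext h.2.2.1 (binCode_injective h.2.2.2)))
      rcases lt_trichotomy u v with huv | huv | huv
      · exact absurd heq (hinj u v huv hv')
      · exact huv
      · exact absurd heq.symm (hinj v u huv hu')
  have hle : t₀ ≤ timeBound n s.length := by
    simp only [Finset.card_product, Finset.card_range, Finset.card_univ, Fintype.card_bool]
      at hcard
    rw [timeBound]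
    lia
  rw [zipRun_eq_of_halted h₀ hle, ← hrun]
  exact ⟨ht, hs⟩

/-! ### Decidability -/

/-- Some machine with `n` states outputs `s` on one of the two blank symbols. -/
def Producible (n : ℕ) (s : List Bool) : Prop :=
  ∃ (i : Bool) (M : Machine n), Outputs M i s

theorem producible_iff_exists_code {n : ℕ} (hn : 0 < n) (s : List Bool) :
    Producible n s ↔ ∃ m ∈ List.range ((4 * n + 2) ^ (2 * n)), ∃ i ∈ [false, true],
      (zipRun (zipTable n m) i (timeBound n s.length)).1 = 0 ∧
        zipOutput (zipRun (zipTable n m) i (timeBound n s.length)) = s := by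
  simp only [← zipOutputs_iff_timeBound hn (zipTable_div_four_le n _)]
  constructor
  · rintro ⟨i, M, hM⟩
    obtain ⟨m, hm, hc⟩ := exists_zipTable_codes hn M
    exact ⟨m, List.mem_range.2 hm, i, by cases i <;> simp,
      (outputs_iff_zipOutputs hn i hc s).1 hM⟩
  · rintro ⟨m, -, i, -, h⟩
    obtain ⟨M, hc⟩ := exists_codes_zipTable n m
    exact ⟨i, M, (outputs_iff_zipOutputs hn i hc s).2 h⟩

theorem primrec₂_nat_pow : Primrec₂ ((· ^ ·) : ℕ → ℕ → ℕ) :=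
  Primrec₂.unpaired'.1 Nat.Primrec.pow

theorem primrec₂_zipStep {α : Type*} [Primcodable α] {f : α → ℕ → Bool → ℕ} {i : α → Bool}
    (hf : Primrec fun x : α × ℕ × Bool => f x.1 x.2.1 x.2.2) (hi : Primrec i) :
    Primrec₂ fun (a : α) (z : Zipper) => zipStep (f a) (i a) z := by
  have hz : Primrec fun x : α × Zipper => x.2 := Primrec.snd
  have hq : Primrec fun x : α × Zipper => x.2.1 := Primrec.fst.comp hz
  have hl : Primrec fun x : α × Zipper => x.2.2.1 := Primrec.fst.comp (Primrec.snd.comp hz)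
  have hhr : Primrec fun x : α × Zipper => x.2.2.2 := Primrec.snd.comp (Primrec.snd.comp hz)
  have hh : Primrec fun x : α × Zipper => x.2.2.2.1 := Primrec.fst.comp hhr
  have hr : Primrec fun x : α × Zipper => x.2.2.2.2 := Primrec.snd.comp hhr
  have hi' : Primrec fun x : α × Zipper => i x.1 := hi.comp Primrec.fst
  have he : Primrec fun x : α × Zipper => f x.1 (x.2.1 - 1) x.2.2.2.1 :=
    hf.comp (Primrec.fst.pair ((Primrec.nat_sub.comp hq (Primrec.const 1)).pair hh))
  have hq' := Primrec.nat_div.comp he (Primrec.const 4)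
  have hb : Primrec fun x : α × Zipper => decide (f x.1 (x.2.1 - 1) x.2.2.2.1 % 2 = 1) :=
    (Primrec.eq.comp (Primrec.nat_mod.comp he (Primrec.const 2)) (Primrec.const 1)).decide
  refine Primrec.ite (Primrec.eq.comp hq (Primrec.const 0)) hz ?_
  refine Primrec.ite (Primrec.eq.comp hq' (Primrec.const 0))
    ((Primrec.const 0).pair (hl.pair (hb.pair hr))) ?_
  refine Primrec.ite (Primrec.eq.comp (Primrec.nat_mod.comp
    (Primrec.nat_div.comp he (Primrec.const 2)) (Primrec.const 2)) (Primrec.const 1)) ?_ ?_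
  · exact hq'.pair ((Primrec.list_cons.comp hb hl).pair
      ((Primrec.option_getD.comp (Primrec.list_head?.comp hr) hi').pair
        (Primrec.list_tail.comp hr)))
  · exact hq'.pair ((Primrec.list_tail.comp hl).pair
      ((Primrec.option_getD.comp (Primrec.list_head?.comp hl) hi').pair
        (Primrec.list_cons.comp hb hr)))

theorem primrec_bool_toNat : Primrec Bool.toNat :=
  (Primrec.cond Primrec.id (Primrec.const 1) (Primrec.const 0)).of_eq fun b => by cases b <;> rfl

theorem primrec_four_mul_add_two : Primrec fun n : ℕ => 4 * n + 2 :=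
  Primrec.nat_add.comp (Primrec.nat_mul.comp (Primrec.const 4) Primrec.id) (Primrec.const 2)

theorem primrec_zipTable :
    Primrec fun x : (ℕ × ℕ) × ℕ × Bool => zipTable x.1.1 x.1.2 x.2.1 x.2.2 := by
  have hB : Primrec fun x : (ℕ × ℕ) × ℕ × Bool => 4 * x.1.1 + 2 :=
    primrec_four_mul_add_two.comp (Primrec.fst.comp Primrec.fst)
  have hm : Primrec fun x : (ℕ × ℕ) × ℕ × Bool => x.1.2 := Primrec.snd.comp Primrec.fst
  have hj : Primrec fun x : (ℕ × ℕ) × ℕ × Bool => 2 * x.2.1 + x.2.2.toNat :=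
    Primrec.nat_add.comp
      (Primrec.nat_mul.comp (Primrec.const 2) (Primrec.fst.comp Primrec.snd))
      (primrec_bool_toNat.comp (Primrec.snd.comp Primrec.snd))
  exact Primrec.nat_add.comp (Primrec.nat_mod.comp
    (Primrec.nat_div.comp hm (primrec₂_nat_pow.comp hB hj)) hB) (Primrec.const 2)

theorem primrec₂_timeBound : Primrec₂ timeBound := by
  have hp : Primrec fun x : ℕ × ℕ => 2 ^ x.2 :=
    primrec₂_nat_pow.comp (Primrec.const 2) Primrec.snd
  exact Primrec.nat_mul.comp (Primrec.succ.comp Primrec.fst)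
    (Primrec.nat_mul.comp hp (Primrec.nat_mul.comp (Primrec.const 2) hp))

theorem primrec_zipOutput : Primrec zipOutput :=
  Primrec.list_append.comp (Primrec.list_reverse.comp (Primrec.fst.comp Primrec.snd))
    (Primrec.list_cons.comp (Primrec.fst.comp (Primrec.snd.comp Primrec.snd))
      (Primrec.snd.comp (Primrec.snd.comp Primrec.snd)))

theorem primrecPred_producible :
    PrimrecPred fun p : List Bool × ℕ => 0 < p.2 ∧ Producible p.2 p.1 := by
  have hrun : Primrec fun x : Bool × ℕ × List Bool × ℕ =>
      zipRun (zipTable x.2.2.2 x.2.1) x.1 (timeBound x.2.2.2 x.2.2.1.length) := by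
    have hn : Primrec fun x : Bool × ℕ × List Bool × ℕ => x.2.2.2 :=
      Primrec.snd.comp (Primrec.snd.comp Primrec.snd)
    have hs : Primrec fun x : Bool × ℕ × List Bool × ℕ => x.2.2.1 :=
      Primrec.fst.comp (Primrec.snd.comp Primrec.snd)
    have hm : Primrec fun x : Bool × ℕ × List Bool × ℕ => x.2.1 := Primrec.fst.comp Primrec.snd
    refine Primrec.nat_iterate (primrec₂_timeBound.comp hn (Primrec.list_length.comp hs))
      ((Primrec.const 1).pair ((Primrec.const []).pair (Primrec.fst.pair (Primrec.const [])))) ?_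
    refine primrec₂_zipStep
      (f := fun x : Bool × ℕ × List Bool × ℕ => zipTable x.2.2.2 x.2.1) ?_ Primrec.fst
    exact primrec_zipTable.comp (((hn.comp Primrec.fst).pair (hm.comp Primrec.fst)).pair
      Primrec.snd)
  have hcheck : PrimrecRel fun (i : Bool) (x : ℕ × List Bool × ℕ) =>
      (zipRun (zipTable x.2.2 x.1) i (timeBound x.2.2 x.2.1.length)).1 = 0 ∧
        zipOutput (zipRun (zipTable x.2.2 x.1) i (timeBound x.2.2 x.2.1.length)) = x.2.1 :=
    (Primrec.eq.comp (Primrec.fst.comp hrun) (Primrec.const 0)).and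
      (Primrec.eq.comp (primrec_zipOutput.comp hrun)
        (Primrec.fst.comp (Primrec.snd.comp Primrec.snd)))
  have hcode : PrimrecRel fun (m : ℕ) (p : List Bool × ℕ) => ∃ i ∈ [false, true],
      (zipRun (zipTable p.2 m) i (timeBound p.2 p.1.length)).1 = 0 ∧
        zipOutput (zipRun (zipTable p.2 m) i (timeBound p.2 p.1.length)) = p.1 :=
    hcheck.exists_mem_list.comp (Primrec.const [false, true]) Primrec.id
  have hrange : Primrec fun p : List Bool × ℕ => List.range ((4 * p.2 + 2) ^ (2 * p.2)) :=
    Primrec.list_range.comp (primrec₂_nat_pow.comp (primrec_four_mul_add_two.comp Primrec.snd)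
      (Primrec.nat_mul.comp (Primrec.const 2) Primrec.snd))
  refine ((Primrec.nat_lt.comp (Primrec.const 0) Primrec.snd).and
    (hcode.exists_mem_list.comp hrange Primrec.id)).of_eq fun p => ?_
  exact and_congr_right fun hn => (producible_iff_exists_code hn p.1).symm

/-! ### The least `k` with `m_k(s) > 0` -/

theorem numOutput_pos_iff (n : ℕ) (i : Bool) (s : List Bool) :
    0 < numOutput n i s ↔ ∃ M : Machine n, Outputs M i s := by
  rw [numOutput, Nat.card_pos_iff, nonempty_subtype]
  exact and_iff_left inferInstance

theorem mTerm_pos_iff (n : ℕ) (s : List Bool) : 0 < mTerm n s ↔ Producible n s := by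
  have : 0 < mTerm n s ↔ 0 < numOutput n false s + numOutput n true s := by
    rw [mTerm, div_pos_iff_of_pos_right (by positivity), Nat.cast_pos]
  rw [this, Nat.add_pos_iff_pos_or_pos, numOutput_pos_iff, numOutput_pos_iff, Producible,
    Bool.exists_bool]

theorem mTerm_nonneg (n : ℕ) (s : List Bool) : 0 ≤ mTerm n s := by
  rw [mTerm]
  positivity

theorem mApprox_pos_iff (k : ℕ) (s : List Bool) :
    0 < mApprox k s ↔ ∃ n, 0 < n ∧ n ≤ k ∧ Producible n s := by
  rw [mApprox, Finset.sum_pos_iff_of_nonneg fun n _ => mTerm_nonneg n s]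
  simp only [Finset.mem_Icc, mTerm_pos_iff, and_assoc, Nat.succ_le_iff]

theorem leastK_eq_of_isLeast {s : List Bool} {k : ℕ}
    (hk : IsLeast {n | 0 < n ∧ Producible n s} k) : leastK s = k := by
  refine IsLeast.csInf_eq ⟨⟨hk.1.1, ?_⟩, fun n hn => ?_⟩
  · exact (mApprox_pos_iff k s).2 ⟨k, hk.1.1, le_rfl, hk.1.2⟩
  · obtain ⟨j, hj, hjn, hp⟩ := (mApprox_pos_iff n s).1 hn.2
    exact (hk.2 ⟨hj, hp⟩).trans hjn

theorem producible_length {s : List Bool} (hs : s ≠ []) : Producible s.length s :=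
  ⟨false, exists_outputs hs⟩

theorem exists_computable_eq_leastK :
    ∃ f : List Bool → ℕ, Computable f ∧ ∀ s : List Bool, s ≠ [] → f s = leastK s := by
  classical
  have hcomp : ComputablePred fun p : List Bool × ℕ =>
      p.1 = [] ∨ 0 < p.2 ∧ Producible p.2 p.1 :=
    ((Primrec.eq.comp Primrec.fst (Primrec.const [])).or
      primrecPred_producible).computablePred
  have hex (s : List Bool) : ∃ n, s = [] ∨ 0 < n ∧ Producible n s := by
    by_cases hs : s = []
    · exact ⟨0, Or.inl hs⟩
    · exact ⟨s.length, Or.inr ⟨List.length_pos_iff.2 hs, producible_length hs⟩⟩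
  refine ⟨fun s => Nat.find (hex s),
    Computable.find (P := fun s n => s = [] ∨ 0 < n ∧ Producible n s) hcomp hex,
    fun s hs => (leastK_eq_of_isLeast ⟨?_, fun n hn => ?_⟩).symm⟩
  · exact (Nat.find_spec (hex s)).resolve_left hs
  · exact Nat.find_min' (hex s) (Or.inr hn)

/-- For every nonempty string `s` the least `k ≥ 1` with `m_k(s) > 0` exists, is at most
`|s|`, and the function computing it is computable. -/
theorem leastK_wellDefined_and_computable :
    (∀ s : List Bool, s ≠ [] →
      (∃ k, (1 ≤ k ∧ 0 < mApprox k s) ∧ k ≤ s.length) ∧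
      1 ≤ leastK s ∧ 0 < mApprox (leastK s) s ∧ leastK s ≤ s.length) ∧
    ∃ f : List Bool → ℕ, Computable f ∧ ∀ s : List Bool, s ≠ [] → f s = leastK s := by
  refine ⟨fun s hs => ?_, exists_computable_eq_leastK⟩
  have hk : 1 ≤ s.length ∧ 0 < mApprox s.length s :=
    have hpos : 0 < s.length := List.length_pos_iff.2 hs
    ⟨hpos, (mApprox_pos_iff _ s).2 ⟨_, hpos, le_rfl, producible_length hs⟩⟩
  have hleast : 1 ≤ leastK s ∧ 0 < mApprox (leastK s) s :=
    Nat.sInf_mem (s := {k | 1 ≤ k ∧ 0 < mApprox k s}) ⟨_, hk⟩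
  exact ⟨⟨_, hk, le_rfl⟩, hleast.1, hleast.2, Nat.sInf_le hk⟩
end
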